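/- Let κ ∈ {0,1}, let v₂ : [0,T] → ℝ be differentiable with v₂(T) = 0 and v₂'(t) = κ v₁(t)(log v₁(t) + v₂(t) − 1) + θ/2, and set v(t,s,z) := −exp(−γ v₁(t)(z − V(t,s)) + v₂(t)), y^g(t,s) := D_s V(t,s) + (1/(γ v₁(t)))(σσᵀ)^{-1}(μ − r·1_d), and c^g(t,s,z) := κ( −(1/γ)(log v₁(t)+v₂(t)) + v₁(t)(z − V(t,s)) ). Let ā : [0,T)×(0,∞)^d → ℝ and let ũ : [0,T)×(0,∞)^d → ℝ be C^{1,2} and solve −ũ_t − r·1_d·D_s ũ − (1/2)Tr[σσᵀ D_{ss} ũ] + κ v₁(t) ũ = ā on [0,T)×(0,∞)^d. Then the function u(t,s,z) := −v(t,s,z) ũ(t,s) satisfies the second corrector equation A^g u(t,s,z) = −v(t,s,z) ā(t,s) for all (t,s,z) ∈ [0,T)×(0,∞)^d×(0,∞), where A^g u := −u_t − μ·D_s u − (1/2)Tr[σσᵀ D_{ss} u] − ( r z + y^g·(μ − r·1_d) − κ c^g ) u_z − (1/2)|σᵀ y^g|² u_{zz} − (σσᵀ y^g)·D_{sz} u.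 -/

import Mathlib

open scoped BigOperators

/-- Partial derivative of `φ : (Fin d → ℝ) → ℝ` in the `i`-th coordinate at `s`. -/
noncomputable def pd {d : ℕ} (φ : (Fin d → ℝ) → ℝ) (i : Fin d) (s : Fin d → ℝ) : ℝ :=
  deriv (fun a => φ (Function.update s i a)) (s i)

/-- The time factor `v₁(t) = r / (κ + e^{-r(T-t)}(r-κ))` of the explicit Merton
value function for exponential utility. -/
noncomputable def v1 (r T κ t : ℝ) : ℝ := r / (κ + Real.exp (-(r * (T - t))) * (r - κ))

theorem isOpen_posOrthant (d : ℕ) : IsOpen {s : Fin d → ℝ | ∀ i, 0 < s i} := by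
  simp only [Set.ofPred_forall]
  exact isOpen_iInter_of_finite fun i => isOpen_lt continuous_const (continuous_apply i)

theorem pd_hasDerivAt {d : ℕ} {φ : (Fin d → ℝ) → ℝ} {s : Fin d → ℝ}
    (h : DifferentiableAt ℝ φ s) (i : Fin d) :
    HasDerivAt (fun a => φ (Function.update s i a)) (fderiv ℝ φ s (Pi.single i 1)) (s i) := by
  have h1 : HasDerivAt (fun a => Function.update s i a) (Pi.single i (1 : ℝ)) (s i) :=
    hasDerivAt_update s i (s i)
  have h2 : HasFDerivAt φ (fderiv ℝ φ s) (Function.update s i (s i)) := by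
    rw [Function.update_eq_self]; exact h.hasFDerivAt
  exact h2.comp_hasDerivAt (s i) h1

theorem pd_eq_fderiv {d : ℕ} {φ : (Fin d → ℝ) → ℝ} {s : Fin d → ℝ}
    (h : DifferentiableAt ℝ φ s) (i : Fin d) :
    pd φ i s = fderiv ℝ φ s (Pi.single i 1) := (pd_hasDerivAt h i).deriv

theorem pd_hasDerivAt' {d : ℕ} {φ : (Fin d → ℝ) → ℝ} {s : Fin d → ℝ}
    (h : DifferentiableAt ℝ φ s) (i : Fin d) :
    HasDerivAt (fun a => φ (Function.update s i a)) (pd φ i s) (s i) := by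
  rw [pd_eq_fderiv h]; exact pd_hasDerivAt h i

theorem diffAt_of_C2 {d : ℕ} {φ : (Fin d → ℝ) → ℝ}
    (h : ContDiffOn ℝ 2 φ {s | ∀ i, 0 < s i}) {s : Fin d → ℝ} (hs : ∀ i, 0 < s i) :
    DifferentiableAt ℝ φ s :=
  (h.differentiableOn (by norm_num)).differentiableAt ((isOpen_posOrthant d).mem_nhds hs)

theorem pd_diffAt_of_C2 {d : ℕ} {φ : (Fin d → ℝ) → ℝ}
    (h : ContDiffOn ℝ 2 φ {s | ∀ i, 0 < s i}) {s : Fin d → ℝ} (hs : ∀ i, 0 < s i)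
    (j : Fin d) : DifferentiableAt ℝ (pd φ j) s := by
  have h1 : ContDiffOn ℝ 1 (fderiv ℝ φ) {s | ∀ i, 0 < s i} :=
    h.fderiv_of_isOpen (isOpen_posOrthant d) (by norm_num)
  have h2 : DifferentiableAt ℝ (fderiv ℝ φ) s :=
    (h1.differentiableOn (by norm_num)).differentiableAt ((isOpen_posOrthant d).mem_nhds hs)
  have h3 : DifferentiableAt ℝ (fun x => fderiv ℝ φ x (Pi.single j 1)) s :=
    h2.clm_apply (differentiableAt_const _)
  refine h3.congr_of_eventuallyEq ?_
  filter_upwards [(isOpen_posOrthant d).mem_nhds hs] with x hx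
  exact pd_eq_fderiv (diffAt_of_C2 h hx) j

/-- First derivative of `exp (-(c (z - φ)) + k) ψ`. -/
theorem pd_expmul {d : ℕ} {φ ψ : (Fin d → ℝ) → ℝ} {s : Fin d → ℝ} (c z k : ℝ)
    (hφ : DifferentiableAt ℝ φ s) (hψ : DifferentiableAt ℝ ψ s) (i : Fin d) :
    pd (fun x => Real.exp (-(c * (z - φ x)) + k) * ψ x) i s
      = Real.exp (-(c * (z - φ s)) + k) * (pd ψ i s + c * pd φ i s * ψ s) := by
  have h1 := pd_hasDerivAt' hφ i
  have h2 := pd_hasDerivAt' hψ i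
  have h3 := ((((h1.const_sub z).const_mul c).neg.add_const k).exp.mul h2).deriv
  simp only [Pi.neg_apply, Function.update_eq_self] at h3
  unfold pd at h3 ⊢
  refine Eq.trans h3 ?_
  ring

theorem pd_congr {d : ℕ} {φ ψ : (Fin d → ℝ) → ℝ} {s : Fin d → ℝ} (hs : ∀ i, 0 < s i)
    (h : ∀ x : Fin d → ℝ, (∀ i, 0 < x i) → φ x = ψ x) (i : Fin d) :
    pd φ i s = pd ψ i s := by
  unfold pd
  apply Filter.EventuallyEq.deriv_eq
  filter_upwards [lt_mem_nhds (hs i)] with a ha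
  apply h
  intro j
  by_cases hj : j = i
  · subst hj; simpa using ha
  · simpa [Function.update_of_ne hj] using hs j

theorem pd_pd_expmul {d : ℕ} {φ ψ : (Fin d → ℝ) → ℝ} {s : Fin d → ℝ} (c z k : ℝ)
    (hφ : ContDiffOn ℝ 2 φ {s | ∀ i, 0 < s i}) (hψ : ContDiffOn ℝ 2 ψ {s | ∀ i, 0 < s i})
    (hs : ∀ i, 0 < s i) (i j : Fin d) :
    pd (pd (fun x => Real.exp (-(c * (z - φ x)) + k) * ψ x) j) i s
      = Real.exp (-(c * (z - φ s)) + k) * (pd (pd ψ j) i s + c * pd (pd φ j) i s * ψ s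
        + c * pd φ j s * pd ψ i s + c * pd φ i s * (pd ψ j s + c * pd φ j s * ψ s)) := by
  rw [pd_congr hs (fun x hx => pd_expmul c z k (diffAt_of_C2 hφ hx) (diffAt_of_C2 hψ hx) j)]
  have d1 := pd_diffAt_of_C2 hφ hs j
  have d2 := pd_diffAt_of_C2 hψ hs j
  have d3 := diffAt_of_C2 hψ hs
  rw [pd_expmul (ψ := fun x => pd ψ j x + c * pd φ j x * ψ x) c z k (diffAt_of_C2 hφ hs)
    (d2.add ((d1.const_mul c).mul d3))]
  have h := ((pd_hasDerivAt' d2 i).add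
    (((pd_hasDerivAt' d1 i).const_mul c).mul (pd_hasDerivAt' d3 i))).deriv
  simp only [Function.update_eq_self] at h
  have h' : pd (fun x => pd ψ j x + c * pd φ j x * ψ x) i s
      = pd (pd ψ j) i s + (c * pd (pd φ j) i s * ψ s + c * pd φ j s * pd ψ i s) := h
  rw [h']
  ring

theorem v1_den_pos {T r κ t : ℝ} (hr : 0 < r) (hκ : κ = 0 ∨ κ = 1) (ht : t < T) :
    0 < κ + Real.exp (-(r * (T - t))) * (r - κ) := by
  have he := Real.exp_pos (-(r * (T - t)))
  have he1 : Real.exp (-(r * (T - t))) < 1 := by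
    rw [Real.exp_lt_one_iff]
    have := mul_pos hr (sub_pos.2 ht)
    linarith
  rcases hκ with h | h <;> subst h <;> nlinarith [mul_pos he hr]

theorem v1_hasDerivAt {T r κ t : ℝ} (hr : 0 < r) (hκ : κ = 0 ∨ κ = 1) (ht : t < T) :
    HasDerivAt (fun a => v1 r T κ a) (-r * v1 r T κ t + κ * v1 r T κ t ^ 2) t := by
  have hD := v1_den_pos hr hκ ht
  have h1 : HasDerivAt (fun a : ℝ => -(r * (T - a))) r t := by
    have := (((hasDerivAt_id t).const_sub T).const_mul r).neg
    exact this.congr_deriv (by ring)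
  have h2 := ((h1.exp.mul_const (r - κ)).const_add κ)
  have h3 := (hasDerivAt_const t r).div h2 hD.ne'
  unfold v1
  refine h3.congr_deriv ?_
  generalize Real.exp (-(r * (T - t))) = e at *
  field_simp
  ring

/-- The algebraic identities for the double sums. -/
theorem sums_aux {d : ℕ} (σ : Matrix (Fin d) (Fin d) ℝ) (hσ : IsUnit σ.det)
    (a m y : Fin d → ℝ) (q : ℝ)
    (hy : ∀ i, y i = a i + q * (σ * σ.transpose)⁻¹.mulVec m i) :
    (∀ i, (σ * σ.transpose).mulVec y i = (σ * σ.transpose).mulVec a i + q * m i) ∧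
    (∑ i, (∑ j, σ j i * y j) ^ 2 = ∑ i, (σ * σ.transpose).mulVec a i * a i
      + 2 * q * ∑ i, m i * a i
      + q ^ 2 * ∑ i, m i * (σ * σ.transpose)⁻¹.mulVec m i) := by
  set S := σ * σ.transpose with hS
  have hSu : IsUnit S.det := by
    rw [hS, Matrix.det_mul, Matrix.det_transpose]; exact hσ.mul hσ
  have hSt : S.transpose = S := by simp [hS]
  set n := S⁻¹.mulVec m with hn
  have hSn : S.mulVec n = m := by
    rw [hn, Matrix.mulVec_mulVec, Matrix.mul_nonsing_inv _ hSu, Matrix.one_mulVec]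
  have hy' : y = a + q • n := by
    funext i; simp [hy i]
  have h1 : S.mulVec y = S.mulVec a + q • m := by
    rw [hy', Matrix.mulVec_add, Matrix.mulVec_smul, hSn]
  refine ⟨fun i => by rw [h1]; simp, ?_⟩
  have h2 : ∑ i, (∑ j, σ j i * y j) ^ 2 = y ⬝ᵥ S.mulVec y := by
    rw [hS, ← Matrix.mulVec_mulVec, Matrix.dotProduct_mulVec, ← Matrix.mulVec_transpose]
    simp only [dotProduct, Matrix.mulVec, Matrix.transpose_apply, sq]
  have h3 : n ⬝ᵥ S.mulVec a = m ⬝ᵥ a := by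
    rw [Matrix.dotProduct_mulVec, ← Matrix.mulVec_transpose, hSt, hSn]
  have h4 : y ⬝ᵥ S.mulVec y = S.mulVec a ⬝ᵥ a + 2 * q * (m ⬝ᵥ a) + q ^ 2 * (m ⬝ᵥ n) := by
    rw [h1, hy']
    simp only [add_dotProduct, dotProduct_add, smul_dotProduct, dotProduct_smul, h3, smul_eq_mul]
    rw [dotProduct_comm a (S.mulVec a), dotProduct_comm a m, dotProduct_comm n m]
    ring
  rw [h2, h4]; rfl

theorem double_sum_aux {d : ℕ} (S : Matrix (Fin d) (Fin d) ℝ) (hS : ∀ i j, S i j = S j i)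
    (s p q : Fin d → ℝ) (P Q : Fin d → Fin d → ℝ) (E c w : ℝ) :
    ∑ i, ∑ j, S i j * (s i * s j * (E * (Q i j + c * P i j * w + c * p j * q i
        + c * p i * (q j + c * p j * w))))
      = E * (∑ i, ∑ j, S i j * (s i * s j * Q i j)
        + c * w * ∑ i, ∑ j, S i j * (s i * s j * P i j)
        + 2 * c * ∑ i, S.mulVec (fun j => s j * p j) i * (s i * q i)
        + c ^ 2 * w * ∑ i, S.mulVec (fun j => s j * p j) i * (s i * p i)) := by
  have e1 : ∑ i, ∑ j, S i j * (s i * s j * (p i * q j))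
      = ∑ i, ∑ j, S i j * (s i * s j * (p j * q i)) := by
    rw [Finset.sum_comm]
    refine Finset.sum_congr rfl fun i _ => Finset.sum_congr rfl fun j _ => ?_
    rw [hS j i]; ring
  have e2 : ∀ x : Fin d → ℝ, ∑ i, S.mulVec (fun j => s j * p j) i * (s i * x i)
      = ∑ i, ∑ j, S i j * (s i * s j * (p j * x i)) := by
    intro x
    refine Finset.sum_congr rfl fun i _ => ?_
    simp only [Matrix.mulVec, dotProduct, Finset.sum_mul]
    exact Finset.sum_congr rfl fun j _ => by ring
  have e3 : (2 : ℝ) * c * ∑ i, ∑ j, S i j * (s i * s j * (p j * q i))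
      = c * ∑ i, ∑ j, S i j * (s i * s j * (p j * q i))
        + c * ∑ i, ∑ j, S i j * (s i * s j * (p i * q j)) := by
    rw [e1]; ring
  rw [e2, e2, e3]
  simp only [Finset.mul_sum, ← Finset.sum_add_distrib]
  exact Finset.sum_congr rfl fun i _ => Finset.sum_congr rfl fun j _ => by ring

theorem stmt6 (d : ℕ) (hd : 1 ≤ d) (T r γ κ : ℝ) (hT : 0 < T) (hr : 0 < r)
    (hγ : 0 < γ) (hκ : κ = 0 ∨ κ = 1)
    (μ : Fin d → ℝ) (σ : Matrix (Fin d) (Fin d) ℝ) (hσ : IsUnit σ.det)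
    (θ : ℝ)
    (hθ : θ = ∑ i, (μ i - r) * (σ * σ.transpose)⁻¹.mulVec (fun j => μ j - r) i)
    (g : (Fin d → ℝ) → ℝ)
    (V : ℝ → (Fin d → ℝ) → ℝ)
    -- V is C^{1,2} on [0,T) × (0,∞)^d, continuous up to time T,
    (hVt : ∀ t ∈ Set.Ico (0 : ℝ) T, ∀ s : Fin d → ℝ, (∀ i, 0 < s i) →
      DifferentiableAt ℝ (fun u => V u s) t)
    (hVs : ∀ t ∈ Set.Ico (0 : ℝ) T, ContDiffOn ℝ 2 (V t) {s | ∀ i, 0 < s i})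
    (hVcont : ContinuousOn (fun q : ℝ × (Fin d → ℝ) => V q.1 q.2)
      (Set.Icc 0 T ×ˢ {s | ∀ i, 0 < s i}))
    -- and solves the Black–Scholes PDE with terminal condition g:
    (hVpde : ∀ t ∈ Set.Ico (0 : ℝ) T, ∀ s : Fin d → ℝ, (∀ i, 0 < s i) →
      -(deriv (fun u => V u s) t) - ∑ i, r * (s i * pd (V t) i s)
        - 1 / 2 * ∑ i, ∑ j, (σ * σ.transpose) i j * (s i * s j * pd (pd (V t) j) i s)
        + r * V t s = 0)
    (hVterm : ∀ s : Fin d → ℝ, (∀ i, 0 < s i) → V T s = g s)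
    -- v₂ solves the ODE with terminal condition 0:
    (v₂ : ℝ → ℝ) (hv₂T : v₂ T = 0)
    (hv₂' : ∀ t ∈ Set.Ico (0 : ℝ) T,
      HasDerivAt v₂ (κ * v1 r T κ t * (Real.log (v1 r T κ t) + v₂ t - 1) + θ / 2) t)
    -- the Merton value function:
    (v : ℝ → (Fin d → ℝ) → ℝ → ℝ)
    (hv : ∀ t s z, v t s z = -Real.exp (-(γ * v1 r T κ t * (z - V t s)) + v₂ t))
    -- the optimal portfolio y^g(t,s) = D_s V + (1/(γv₁))(σσᵀ)⁻¹(μ - r1):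
    (yg : ℝ → (Fin d → ℝ) → Fin d → ℝ)
    (hyg : ∀ t s i, yg t s i = s i * pd (V t) i s
      + 1 / (γ * v1 r T κ t) * (σ * σ.transpose)⁻¹.mulVec (fun j => μ j - r) i)
    -- the optimal consumption c^g(t,s,z):
    (cg : ℝ → (Fin d → ℝ) → ℝ → ℝ)
    (hcg : ∀ t s z, cg t s z =
      κ * (-(1 / γ) * (Real.log (v1 r T κ t) + v₂ t) + v1 r T κ t * (z - V t s)))
    -- ā and ũ, a C^{1,2} solution of the linear PDE with source ā:
    (abar : ℝ → (Fin d → ℝ) → ℝ)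
    (ut : ℝ → (Fin d → ℝ) → ℝ)
    (hut : ∀ t ∈ Set.Ico (0 : ℝ) T, ∀ s : Fin d → ℝ, (∀ i, 0 < s i) →
      DifferentiableAt ℝ (fun u => ut u s) t)
    (hus : ∀ t ∈ Set.Ico (0 : ℝ) T, ContDiffOn ℝ 2 (ut t) {s | ∀ i, 0 < s i})
    (hupde : ∀ t ∈ Set.Ico (0 : ℝ) T, ∀ s : Fin d → ℝ, (∀ i, 0 < s i) →
      -(deriv (fun a => ut a s) t) - ∑ i, r * (s i * pd (ut t) i s)
        - 1 / 2 * ∑ i, ∑ j, (σ * σ.transpose) i j * (s i * s j * pd (pd (ut t) j) i s)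
        + κ * v1 r T κ t * ut t s = abar t s)
    -- the candidate solution u(t,s,z) = -v(t,s,z) ũ(t,s) of the second corrector equation:
    (u : ℝ → (Fin d → ℝ) → ℝ → ℝ)
    (hu : ∀ t s z, u t s z = -(v t s z) * ut t s) :
    -- Then A^g u = -v ā on [0,T) × (0,∞)^d × (0,∞):
    ∀ t ∈ Set.Ico (0 : ℝ) T, ∀ s : Fin d → ℝ, (∀ i, 0 < s i) → ∀ z : ℝ, 0 < z →
      -(deriv (fun a => u a s z) t)
        - ∑ i, μ i * (s i * pd (fun s' => u t s' z) i s)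
        - 1 / 2 * ∑ i, ∑ j, (σ * σ.transpose) i j
            * (s i * s j * pd (pd (fun s' => u t s' z) j) i s)
        - (r * z + (∑ i, yg t s i * (μ i - r)) - κ * cg t s z)
            * deriv (fun z' => u t s z') z
        - 1 / 2 * (∑ i, (∑ j, σ j i * yg t s j) ^ 2)
            * deriv (deriv fun z' => u t s z') z
        - ∑ i, (σ * σ.transpose).mulVec (yg t s) i
            * (s i * pd (fun s' => deriv (fun z' => u t s' z') z) i s)
      = -(v t s z) * abar t s := by
  intro t ht s hs z hz
  have hD := v1_den_pos hr hκ ht.2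
  have hw : 0 < v1 r T κ t := div_pos hr hD
  have hw' := v1_hasDerivAt hr hκ ht.2
  have hU : ∀ t s z, u t s z
      = Real.exp (-(γ * v1 r T κ t * (z - V t s)) + v₂ t) * ut t s := by
    intro t s z; rw [hu, hv]; ring
  have hpde := hVpde t ht s hs
  have hpdeu := hupde t ht s hs
  have hVd := (hVt t ht s hs).hasDerivAt
  have hud := (hut t ht s hs).hasDerivAt
  have hv2 := hv₂' t ht
  have hV2 := hVs t ht
  have hu2 := hus t ht
  have hVx := diffAt_of_C2 hV2 hs
  have hux := diffAt_of_C2 hu2 hs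
  -- time derivative
  have Dt := (((((hw'.const_mul γ).mul (hVd.const_sub z)).neg.add hv2).exp).mul hud).deriv
  -- wealth derivatives
  have Dz : ∀ x y, deriv (fun z' => u t x z') y
      = Real.exp (-(γ * v1 r T κ t * (y - V t x)) + v₂ t) * (-(γ * v1 r T κ t) * ut t x) := by
    intro x y
    simp only [hU]
    have := ((((((hasDerivAt_id y).sub_const (V t x)).const_mul
      (γ * v1 r T κ t)).neg.add_const (v₂ t)).exp).mul_const (ut t x)).deriv
    refine Eq.trans this ?_
    simp only [id, Pi.neg_apply]
    ring
  have Dzz : deriv (deriv fun z' => u t s z') z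
      = Real.exp (-(γ * v1 r T κ t * (z - V t s)) + v₂ t) * ((γ * v1 r T κ t) ^ 2 * ut t s) := by
    rw [show (deriv fun z' => u t s z') = fun y =>
      Real.exp (-(γ * v1 r T κ t * (y - V t s)) + v₂ t) * (-(γ * v1 r T κ t) * ut t s) from
        funext fun y => Dz s y]
    have := ((((((hasDerivAt_id z).sub_const (V t s)).const_mul
      (γ * v1 r T κ t)).neg.add_const (v₂ t)).exp).mul_const
        (-(γ * v1 r T κ t) * ut t s)).deriv
    refine Eq.trans this ?_
    simp only [id, Pi.neg_apply]
    ring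
  have Ds : ∀ i, pd (fun s' => u t s' z) i s
      = Real.exp (-(γ * v1 r T κ t * (z - V t s)) + v₂ t)
        * (pd (ut t) i s + γ * v1 r T κ t * pd (V t) i s * ut t s) := by
    intro i
    simp only [hU]
    exact pd_expmul _ z _ hVx hux i
  have Dss : ∀ i j, pd (pd (fun s' => u t s' z) j) i s
      = Real.exp (-(γ * v1 r T κ t * (z - V t s)) + v₂ t)
        * (pd (pd (ut t) j) i s + γ * v1 r T κ t * pd (pd (V t) j) i s * ut t s
          + γ * v1 r T κ t * pd (V t) j s * pd (ut t) i s
          + γ * v1 r T κ t * pd (V t) i s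
            * (pd (ut t) j s + γ * v1 r T κ t * pd (V t) j s * ut t s)) := by
    intro i j
    simp only [hU]
    exact pd_pd_expmul (γ * v1 r T κ t) z (v₂ t) hV2 hu2 hs i j
  have Dsz : ∀ i, pd (fun s' => deriv (fun z' => u t s' z') z) i s
      = Real.exp (-(γ * v1 r T κ t * (z - V t s)) + v₂ t)
        * (-(γ * v1 r T κ t) * (pd (ut t) i s + γ * v1 r T κ t * pd (V t) i s * ut t s)) := by
    intro i
    simp only [Dz]
    rw [pd_expmul (ψ := fun x => -(γ * v1 r T κ t) * ut t x) _ z _ hVx (hux.const_mul _) i]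
    have h := ((pd_hasDerivAt' hux i).const_mul (-(γ * v1 r T κ t))).deriv
    have h' : pd (fun x => -(γ * v1 r T κ t) * ut t x) i s
      = -(γ * v1 r T κ t) * pd (ut t) i s := h
    rw [h']
    ring
  have Dt' : deriv (fun a => u a s z) t
      = Real.exp (-(γ * v1 r T κ t * (z - V t s)) + v₂ t)
        * (deriv (fun a => ut a s) t + ut t s *
          (-(γ * (-r * v1 r T κ t + κ * v1 r T κ t ^ 2) * (z - V t s))
            + γ * v1 r T κ t * deriv (fun a => V a s) t
            + (κ * v1 r T κ t * (Real.log (v1 r T κ t) + v₂ t - 1) + θ / 2))) := by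
    simp only [hU]
    refine Eq.trans Dt ?_
    simp only [Pi.add_apply, Pi.neg_apply, Pi.mul_apply]
    ring
  obtain ⟨hSy, hyy⟩ := sums_aux σ hσ (fun i => s i * pd (V t) i s)
    (fun j => μ j - r) (yg t s)
    (1 / (γ * v1 r T κ t)) (fun i => hyg t s i)
  have hsym : ∀ i j, (σ * σ.transpose) i j = (σ * σ.transpose) j i := by
    intro i j
    simp only [Matrix.mul_apply, Matrix.transpose_apply]
    exact Finset.sum_congr rfl fun k _ => mul_comm _ _
  rw [Dt', Dz, Dzz, hyy]
  simp only [Ds, Dss, Dsz, hSy]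
  rw [double_sum_aux _ hsym s (fun i => pd (V t) i s) (fun i => pd (ut t) i s)
    (fun i j => pd (pd (V t) j) i s) (fun i j => pd (pd (ut t) j) i s)]
  rw [← hθ, hcg, hv, ← hpdeu]
  generalize hq : (1 : ℝ) / (γ * v1 r T κ t) = q at *
  have hqc : q * (γ * v1 r T κ t) = 1 := by
    rw [← hq]; field_simp
  generalize hE : Real.exp (-(γ * v1 r T κ t * (z - V t s)) + v₂ t) = E
  have s1 : ∑ i, μ i * (s i * (E * (pd (ut t) i s + γ * v1 r T κ t * pd (V t) i s * ut t s)))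
      = E * (∑ i, (μ i - r) * (s i * pd (ut t) i s) + ∑ i, r * (s i * pd (ut t) i s)
        + γ * v1 r T κ t * ut t s * (∑ i, (μ i - r) * (s i * pd (V t) i s)
          + ∑ i, r * (s i * pd (V t) i s))) := by
    simp only [Finset.mul_sum, ← Finset.sum_add_distrib]
    exact Finset.sum_congr rfl fun i _ => by ring
  have s2 : ∑ i, yg t s i * (μ i - r) = ∑ i, (μ i - r) * (s i * pd (V t) i s) + q * θ := by
    rw [hθ]
    simp only [Finset.mul_sum, ← Finset.sum_add_distrib]
    exact Finset.sum_congr rfl fun i _ => by rw [hyg, hq]; ring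
  have s3 : ∑ i, ((σ * σ.transpose).mulVec (fun i => s i * pd (V t) i s) i + q * (μ i - r))
      * (s i * (E * (-(γ * v1 r T κ t)
        * (pd (ut t) i s + γ * v1 r T κ t * pd (V t) i s * ut t s))))
      = -(γ * v1 r T κ t) * E * (
        ∑ i, (σ * σ.transpose).mulVec (fun i => s i * pd (V t) i s) i * (s i * pd (ut t) i s)
        + q * ∑ i, (μ i - r) * (s i * pd (ut t) i s)
        + γ * v1 r T κ t * ut t s * (
        ∑ i, (σ * σ.transpose).mulVec (fun i => s i * pd (V t) i s) i * (s i * pd (V t) i s)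
        + q * ∑ i, (μ i - r) * (s i * pd (V t) i s))) := by
    simp only [Finset.mul_sum, ← Finset.sum_add_distrib]
    exact Finset.sum_congr rfl fun i _ => by ring
  rw [s1, s2, s3]
  clear s1 s2 s3 hSy hyy Dt' Dt Dsz Dss Ds Dzz Dz hpdeu
  have hκ2 : κ * κ = κ := by rcases hκ with h | h <;> simp [h]
  have hg1 : γ * (1 / γ) = 1 := by field_simp
  generalize ∑ i, (μ i - r) * (s i * pd (ut t) i s) = mb
  generalize ∑ i, (μ i - r) * (s i * pd (V t) i s) = ma
  generalize ∑ i, r * (s i * pd (ut t) i s) = rb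
  generalize hra : ∑ i, r * (s i * pd (V t) i s) = ra at hpde ⊢
  generalize ∑ i, (σ * σ.transpose).mulVec (fun i => s i * pd (V t) i s) i * (s i * pd (V t) i s) = aSa
  generalize ∑ i, (σ * σ.transpose).mulVec (fun i => s i * pd (V t) i s) i * (s i * pd (ut t) i s) = aSb
  generalize hTV : ∑ i, ∑ j, (σ * σ.transpose) i j * (s i * s j * pd (pd (V t) j) i s) = TV at hpde ⊢
  generalize ∑ i, ∑ j, (σ * σ.transpose) i j * (s i * s j * pd (pd (ut t) j) i s) = TU
  generalize Real.log (v1 r T κ t) = L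
  generalize v1 r T κ t = w at *
  have hVt' : deriv (fun a => V a s) t = r * V t s - ra - 1 / 2 * TV := by linarith
  rw [hVt']
  generalize deriv (fun a => ut a s) t = U'
  generalize ut t s = U
  generalize V t s = W
  generalize v₂ t = k
  generalize 1 / γ = gi at *
  rcases hκ with h | h <;> subst h
  · linear_combination (E * U * θ + E * mb - 1 / 2 * θ * U * E * (q * (γ * w) + 1)) * hqc
  · linear_combination (E * U * θ + E * mb - 1 / 2 * θ * U * E * (q * (γ * w) + 1)) * hqc
      + E * U * w * (L + k) * hg1
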